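/- Lemma (nonzero sum, sum not in the set): let Ω be a finite set of vectors in ℤ₂ⁿ with d = |Ω|, and suppose u := Σ_{w ∈ Ω} w ≠ 0 and u ∉ Ω. Then for every v ∈ ℤ₂ⁿ the eigenvalue λ_v = Σ_{w ∈ Ω} (-1)^{w·v} satisfies: λ_v = d - 4k_v if u·v is even, and λ_v = d - 4k_v + 2 if u·v is odd, for some natural number k_v with 0 ≤ k_v ≤ ⌊(d+1)/2⌋. Equivalently, λ_v ≡ d (mod 4) when u·v is even and λ_v ≡ d + 2 (mod 4) when u·v is odd. -/

import Mathlib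

open Matrix Complex

noncomputable section

/-- The group `ℤ₂ⁿ`, realized as functions `Fin n → ZMod 2` with pointwise addition (XOR). -/
abbrev G (n : ℕ) := Fin n → ZMod 2

/-- The natural-number scalar product `w·v = Σᵢ (w i).val * (v i).val`. -/
def dot {n : ℕ} (w v : G n) : ℕ := ∑ i, (w i).val * (v i).val

/-- Adjacency matrix of the cubelike graph `X(ℤ₂ⁿ, Ω)`. -/
def adjMatrix {n : ℕ} (Ω : Finset (G n)) : Matrix (G n) (G n) ℂ :=
  Matrix.of fun x y => if x + y ∈ Ω then 1 else 0

/-- Eigenvalue `λ_v = Σ_{w ∈ Ω} (-1)^(w·v)` of the cubelike graph `X(ℤ₂ⁿ, Ω)`. -/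
def eigval {n : ℕ} (Ω : Finset (G n)) (v : G n) : ℤ := ∑ w ∈ Ω, (-1 : ℤ) ^ dot w v

/-- The parity of `w·v` is the `ZMod 2`-valued dot product. -/
lemma dot_cast {n : ℕ} (w v : G n) : (dot w v : ZMod 2) = w ⬝ᵥ v := by
  simp [dot, dotProduct]

/-- The parity of `(∑ w ∈ Ω, w)·v` is that of the number of `w ∈ Ω` with `w·v` odd. -/
lemma even_dot_sum_iff {n : ℕ} (Ω : Finset (G n)) (v : G n) :
    Even (dot (∑ w ∈ Ω, w) v) ↔ Even (Ω.filter fun w => Odd (dot w v)).card := by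
  rw [← Finset.even_sum_iff_even_card_odd, ← ZMod.natCast_eq_zero_iff_even,
    ← ZMod.natCast_eq_zero_iff_even, Nat.cast_sum, dot_cast, sum_dotProduct]
  simp only [dot_cast]

/-- Each `w ∈ Ω` with `w·v` odd lowers the eigenvalue from `|Ω|` by two. -/
lemma eigval_eq_card_sub {n : ℕ} (Ω : Finset (G n)) (v : G n) :
    eigval Ω v = Ω.card - 2 * (Ω.filter fun w => Odd (dot w v)).card := by
  have hterm (w : G n) : (-1 : ℤ) ^ dot w v = 1 - 2 * if Odd (dot w v) then 1 else 0 := by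
    split_ifs with h
    · simp [h.neg_one_pow]
    · simp [(Nat.not_odd_iff_even.mp h).neg_one_pow]
  simp only [eigval, hterm, Finset.sum_sub_distrib, ← Finset.mul_sum, Finset.sum_boole]
  simp

/-- If u = ⊕_{w ∈ Ω} w is nonzero and u ∉ Ω, then λ_v = d - 4k when u·v is even and
λ_v = d - 4k + 2 when u·v is odd, with 0 ≤ k ≤ ⌊(d+1)/2⌋. -/
theorem eigval_of_sum_not_mem {n : ℕ} (Ω : Finset (G n))
    (hu : (∑ w ∈ Ω, w) ≠ 0) (hmem : (∑ w ∈ Ω, w) ∉ Ω) (v : G n) :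
    ∃ k : ℕ, k ≤ (Ω.card + 1) / 2 ∧
      eigval Ω v =
        if Even (dot (∑ w ∈ Ω, w) v) then (Ω.card : ℤ) - 4 * k
        else (Ω.card : ℤ) - 4 * k + 2 := by
  have hcard := Ω.card_filter_le fun w => Odd (dot w v)
  simp only [even_dot_sum_iff, eigval_eq_card_sub]
  generalize (Ω.filter fun w => Odd (dot w v)).card = m at *
  refine ⟨(m + 1) / 2, by lia, ?_⟩
  split_ifs with h
  · obtain ⟨k, rfl⟩ := h
    lia
  · obtain ⟨k, rfl⟩ := Nat.not_even_iff_odd.mp h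
    lia

end
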